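/- Let T = T_1 ∨ T_2 ∨ ⋯ ∨ T_k be the wedge product of plane rooted trees T_1,…,T_k (identified at their common root). Then Q(T) = (|E(T)| choose |E(T_1)|, |E(T_2)|, …, |E(T_k)|)_q · Π_{i=1}^{k} Q(T_i), where |E(T)| = |E(T_1)| + ⋯ + |E(T_k)|. -/

import Mathlib

/-- A plane rooted tree: a root with an ordered list of plane rooted subtrees. -/
inductive PTree : Type where
  | node : List PTree → PTree

namespace PTree

mutual
/-- Number of edges of a plane rooted tree. -/
def edges : PTree → ℕ
  | .node l => edgesL l
def edgesL : List PTree → ℕ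
  | [] => 0
  | t :: ts => (edges t + 1) + edgesL ts
end

mutual
/-- Number of vertices of a plane rooted tree. -/
def vertices : PTree → ℕ
  | .node l => 1 + verticesL l
def verticesL : List PTree → ℕ
  | [] => 0
  | t :: ts => vertices t + verticesL ts
end

mutual
/-- `plucks T` is the list, indexed by the leaves `v` of `T`, of the pairs
`(r(T,v), T - v)`, where `r(T,v)` is the number of vertices strictly to the
right of the path from `v` to the root, and `T - v` is `T` with the leaf `v`
(and its edge) deleted. -/
def plucks : PTree → List (ℕ × PTree)
  | .node l => (plucksL l).map (fun p => (p.1, PTree.node p.2))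
def plucksL : List PTree → List (ℕ × List PTree)
  | [] => []
  | t :: ts =>
      (match t with
       | .node [] => [(verticesL ts, ts)]
       | .node (s :: ss) =>
          (plucks (.node (s :: ss))).map (fun p => (p.1 + verticesL ts, p.2 :: ts)))
      ++ (plucksL ts).map (fun p => (p.1, t :: p.2))
end

/-- The plucking polynomial, computed with a fuel parameter (the fuel is the
number of edges; each plucking removes exactly one edge). -/
noncomputable def Qfuel : ℕ → PTree → Polynomial ℤ
  | 0, _ => 1
  | (k+1), t =>
      if edges t = 0 then 1
      else ((plucks t).map (fun p => Polynomial.X ^ p.1 * Qfuel k p.2)).sum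

/-- The plucking polynomial `Q(T)` of a plane rooted tree: `Q(T) = 1` if `T` has
no edges, and otherwise `Q(T) = Σ_v q^{r(T,v)} Q(T - v)`, summed over the leaves of `T`. -/
noncomputable def Q (t : PTree) : Polynomial ℤ := Qfuel (edges t) t

end PTree

/-- The `q`-analogue `[a]_q = 1 + q + ⋯ + q^{a-1}`. -/
noncomputable def qInt (a : ℕ) : Polynomial ℤ := (Finset.range a).sum (fun i => Polynomial.X ^ i)

/-- The `q`-factorial `[a]_q! = [1]_q [2]_q ⋯ [a]_q`. -/
noncomputable def qFact : ℕ → Polynomial ℤ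
  | 0 => 1
  | (a+1) => qFact a * qInt (a+1)

/-- The `q`-multinomial coefficient
`(a₁+⋯+a_k choose a₁,…,a_k)_q = [a₁+⋯+a_k]_q! / ([a₁]_q! ⋯ [a_k]_q!)`
(the division, by a monic polynomial, is exact). -/
noncomputable def qMultinomial (l : List ℕ) : Polynomial ℤ :=
  qFact l.sum /ₘ (l.map qFact).prod

/-- The Gaussian binomial coefficient `(a+c choose a)_q`. -/
noncomputable def qBinom (a c : ℕ) : Polynomial ℤ := qMultinomial [a, c]


namespace PTree

theorem edgesL_append (A B : List PTree) : edgesL (A ++ B) = edgesL A + edgesL B := by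
  induction A with
  | nil => simp [edgesL]
  | cons t ts ih => simp [edgesL, ih, add_assoc]

theorem edgesL_eq_zero {L : List PTree} (h : edgesL L = 0) : L = [] := by
  cases L with
  | nil => rfl
  | cons t ts => simp [edgesL] at h

mutual
theorem vertices_eq : ∀ t : PTree, vertices t = edges t + 1
  | .node l => by rw [vertices, edges, verticesL_eq l, add_comm]
theorem verticesL_eq : ∀ l : List PTree, verticesL l = edgesL l
  | [] => by rw [verticesL, edgesL]
  | t :: ts => by rw [verticesL, edgesL, vertices_eq t, verticesL_eq ts]
end

mutual
/-- Plucking a leaf removes exactly one edge. -/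
theorem edges_of_mem_plucks : ∀ (t : PTree) (p : ℕ × PTree), p ∈ plucks t → edges p.2 + 1 = edges t
  | .node l, p, hp => by
    rw [plucks, List.mem_map] at hp
    obtain ⟨q, hq, rfl⟩ := hp
    simpa only [edges] using edgesL_of_mem_plucksL l q hq
theorem edgesL_of_mem_plucksL :
    ∀ (l : List PTree) (p : ℕ × List PTree), p ∈ plucksL l → edgesL p.2 + 1 = edgesL l
  | [], p, hp => by simp [plucksL] at hp
  | .node [] :: ts, p, hp => by
    rw [plucksL, List.mem_append, List.mem_map] at hp
    rcases hp with hp | ⟨q, hq, rfl⟩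
    · rw [List.mem_singleton] at hp
      subst hp
      simp only [edgesL, edges]
      omega
    · have := edgesL_of_mem_plucksL ts q hq
      simp only [edgesL]
      omega
  | .node (s :: ss) :: ts, p, hp => by
    rw [plucksL, List.mem_append, List.mem_map, List.mem_map] at hp
    rcases hp with ⟨q, hq, rfl⟩ | ⟨q, hq, rfl⟩
    · have := edges_of_mem_plucks (.node (s :: ss)) q hq
      simp only [edgesL] at this ⊢
      omega
    · have := edgesL_of_mem_plucksL ts q hq
      simp only [edgesL]
      omega
end

theorem plucksL_append (A B : List PTree) :
    plucksL (A ++ B) =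
      (plucksL A).map (fun p => (p.1 + edgesL B, p.2 ++ B)) ++
        (plucksL B).map (fun p => (p.1, A ++ p.2)) := by
  induction A with
  | nil => simp [plucksL]
  | cons t ts ih =>
    rcases t with ⟨_ | ⟨s, ss⟩⟩ <;>
      simp [plucksL, ih, verticesL_eq, edgesL_append, Function.comp_def, add_assoc]

theorem Q_node_nil : Q (.node []) = 1 := by
  simp [Q, edges, edgesL, Qfuel]

theorem Q_node_of_ne_nil {L : List PTree} (h : L ≠ []) :
    Q (.node L) = ((plucksL L).map (fun p => Polynomial.X ^ p.1 * Q (.node p.2))).sum := by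
  obtain ⟨k, hk⟩ := Nat.exists_eq_succ_of_ne_zero (mt edgesL_eq_zero h)
  have hk' : edges (.node L) = k + 1 := by rw [edges, hk]
  rw [Q, hk', Qfuel, if_neg (by omega), plucks, List.map_map]
  congr 1
  refine List.map_congr_left fun p hp => ?_
  have hp' : edges (.node p.2) = k := by
    have := edgesL_of_mem_plucksL L p hp
    rw [edges]
    omega
  simp only [Function.comp_apply, Q, hp']

end PTree

theorem qInt_add (a b : ℕ) : qInt (a + b) = qInt b + Polynomial.X ^ b * qInt a := by
  rw [qInt, add_comm a b, Finset.sum_range_add, qInt, qInt, Finset.mul_sum]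
  simp only [pow_add]

theorem monic_qFact (a : ℕ) : (qFact a).Monic := by
  induction a with
  | zero => exact Polynomial.monic_one
  | succ a ih => exact ih.mul (Polynomial.monic_geom_sum_X a.succ_ne_zero)

theorem monic_prod_map_qFact (l : List ℕ) : (l.map qFact).prod.Monic := by
  induction l with
  | nil => exact Polynomial.monic_one
  | cons a l ih => simpa using (monic_qFact a).mul ih

theorem qFact_mul_qFact_dvd (a b : ℕ) : qFact a * qFact b ∣ qFact (a + b) := by
  induction a generalizing b with
  | zero => simp [qFact]
  | succ a iha =>
    induction b with
    | zero => simp [qFact]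
    | succ b ihb =>
      obtain ⟨G, hG⟩ := iha (b + 1)
      obtain ⟨H, hH⟩ := ihb
      refine ⟨Polynomial.X ^ (b + 1) * G + H, ?_⟩
      have hF : qFact (a + 1 + (b + 1)) = qFact (a + (b + 1)) * qInt (a + 1 + (b + 1)) := by
        rw [show a + 1 + (b + 1) = a + (b + 1) + 1 by ring, qFact]
      rw [show a + 1 + b = a + (b + 1) by ring] at hH
      rw [hF, qInt_add, mul_add, ← mul_assoc, mul_comm _ (Polynomial.X ^ (b + 1)), mul_assoc]
      nth_rw 1 [hH]
      rw [hG]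
      simp only [qFact]
      ring

theorem prod_map_qFact_dvd (l : List ℕ) : (l.map qFact).prod ∣ qFact l.sum := by
  induction l with
  | nil => simp [qFact]
  | cons a l ih =>
    simpa using (mul_dvd_mul_left (qFact a) ih).trans (qFact_mul_qFact_dvd a l.sum)

theorem prod_map_qFact_mul_qMultinomial (l : List ℕ) :
    (l.map qFact).prod * qMultinomial l = qFact l.sum := by
  obtain ⟨G, hG⟩ := prod_map_qFact_dvd l
  rw [qMultinomial, hG, Polynomial.mul_divByMonic_cancel_left _ (monic_prod_map_qFact l)]

namespace PTree

/-- The wedge product formula for two trees, with denominators cleared. -/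
theorem qFact_mul_Q_append (A B : List PTree) :
    qFact (edgesL A) * qFact (edgesL B) * Q (.node (A ++ B)) =
      qFact (edgesL A + edgesL B) * (Q (.node A) * Q (.node B)) := by
  induction hn : edgesL A + edgesL B using Nat.strong_induction_on generalizing A B with
  | _ n ih =>
  subst hn
  by_cases hA : A = []
  · simp [hA, edgesL, qFact, Q_node_nil]
  by_cases hB : B = []
  · simp [hB, edgesL, qFact, Q_node_nil]
  obtain ⟨a, ha⟩ := Nat.exists_eq_succ_of_ne_zero (mt edgesL_eq_zero hA)
  obtain ⟨b, hb⟩ := Nat.exists_eq_succ_of_ne_zero (mt edgesL_eq_zero hB)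
  have hleft : ∀ p ∈ plucksL A,
      qFact (a + 1) * qFact (b + 1) * (Polynomial.X ^ (p.1 + (b + 1)) * Q (.node (p.2 ++ B))) =
        Polynomial.X ^ (b + 1) * qInt (a + 1) * qFact (a + b + 1) * Q (.node B) *
          (Polynomial.X ^ p.1 * Q (.node p.2)) := by
    intro p hp
    have he := edgesL_of_mem_plucksL A p hp
    have hpa : edgesL p.2 = a := by omega
    have := ih (a + b + 1) (by omega) p.2 B (by omega)
    rw [hpa, hb] at this
    rw [qFact, pow_add]
    linear_combination Polynomial.X ^ p.1 * Polynomial.X ^ (b + 1) * qInt (a + 1) * this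
  have hright : ∀ p ∈ plucksL B,
      qFact (a + 1) * qFact (b + 1) * (Polynomial.X ^ p.1 * Q (.node (A ++ p.2))) =
        qInt (b + 1) * qFact (a + b + 1) * Q (.node A) *
          (Polynomial.X ^ p.1 * Q (.node p.2)) := by
    intro p hp
    have he := edgesL_of_mem_plucksL B p hp
    have hpb : edgesL p.2 = b := by omega
    have := ih (a + b + 1) (by omega) A p.2 (by omega)
    rw [hpb, ha] at this
    rw [qFact.eq_2 b]
    linear_combination Polynomial.X ^ p.1 * qInt (b + 1) * this
  have hF : qFact (a + 1 + (b + 1)) =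
      qFact (a + b + 1) * (qInt (b + 1) + Polynomial.X ^ (b + 1) * qInt (a + 1)) := by
    rw [← qInt_add, show a + 1 + (b + 1) = a + b + 1 + 1 by ring, qFact]
  rw [Q_node_of_ne_nil (L := A ++ B) (by simp [hA]), plucksL_append, ha, hb, Nat.succ_eq_add_one,
    Nat.succ_eq_add_one, List.map_append, List.sum_append, List.map_map, List.map_map, mul_add,
    ← List.sum_map_mul_left, ← List.sum_map_mul_left]
  simp only [Function.comp_apply]
  rw [List.map_congr_left hleft, List.map_congr_left hright, List.sum_map_mul_left,
    List.sum_map_mul_left, ← Q_node_of_ne_nil hA, ← Q_node_of_ne_nil hB, hF]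
  ring

theorem edges_node_flatten (Ls : List (List PTree)) :
    edges (.node Ls.flatten) = (Ls.map (fun L => edges (.node L))).sum := by
  simp only [edges]
  induction Ls with
  | nil => simp [edgesL]
  | cons L Ls ih => simp [edgesL_append, ih]

/-- The wedge product formula with denominators cleared. -/
theorem prod_qFact_mul_Q_flatten (Ls : List (List PTree)) :
    ((Ls.map (fun L => edges (.node L))).map qFact).prod * Q (.node Ls.flatten) =
      qFact (Ls.map (fun L => edges (.node L))).sum *
        (Ls.map (fun L => Q (.node L))).prod := by
  induction Ls with
  | nil => simp [qFact, Q_node_nil]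
  | cons L Ls ih =>
    have hL := qFact_mul_Q_append L Ls.flatten
    have he := edges_node_flatten Ls
    rw [← he] at ih
    simp only [List.map_cons, List.prod_cons, List.sum_cons, List.flatten_cons, ← he]
    rw [edges.eq_1 Ls.flatten] at ih ⊢
    rw [edges.eq_1 L]
    apply mul_left_cancel₀ (monic_qFact (edgesL Ls.flatten)).ne_zero
    linear_combination ((Ls.map (fun L => edges (.node L))).map qFact).prod * hL +
      qFact (edgesL L + edgesL Ls.flatten) * Q (.node L) * ih

end PTree

/-- **Wedge product formula.** For plane rooted trees `Tᵢ = node Lᵢ`, `i = 1,…,k`, the wedge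
product `T = T₁ ∨ ⋯ ∨ T_k = node (L₁ ⧺ ⋯ ⧺ L_k)` (identification at the common root)
satisfies `Q(T) = (|E(T)| choose |E(T₁)|, …, |E(T_k)|)_q · Π_{i=1}^{k} Q(Tᵢ)`, where
`|E(T)| = |E(T₁)| + ⋯ + |E(T_k)|`. -/
theorem plucking_wedge (Ls : List (List PTree)) :
    PTree.edges (.node Ls.flatten) = (Ls.map (fun L => PTree.edges (.node L))).sum ∧
    PTree.Q (.node Ls.flatten) =
      qMultinomial (Ls.map (fun L => PTree.edges (.node L))) *
        (Ls.map (fun L => PTree.Q (.node L))).prod := by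
  refine ⟨PTree.edges_node_flatten Ls, ?_⟩
  apply mul_left_cancel₀
    (monic_prod_map_qFact (Ls.map (fun L => PTree.edges (.node L)))).ne_zero
  rw [PTree.prod_qFact_mul_Q_flatten, ← mul_assoc, prod_map_qFact_mul_qMultinomial]
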